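/- Define doubly-indexed sequences of natural numbers ν_{r,s} and ν^{(I)}_{r,s} by: ν_{0,s} = 1 for all s ≥ 0; for r ≥ 1 and s ≥ 0, ν^{(I)}_{r,s} = ∑_{j=0}^{⌊s/r⌋} (ν_{r−1,r})^j · ν_{r−1, s−jr}, and ν_{r,s} = ∑_{j=0}^{⌊s/r⌋} (3 ν_{r−1,r})^j · ν^{(I)}_{r, s−jr}. Then for every r ≥ 1 the diagonal terms satisfy ν_{r,r} ≤ 5^{2r−1} · C_{r−1}, where C_m denotes the m-th Catalan number; consequently ν_{r,r} ≤ 5^{2r−1} · 4^{r−1} = 100^r/20. -/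

import Mathlib

/-- The sequence `ν_{r,s}` counting the number of terms generated at step `r`,
order `s` of the normal form algorithm:
`ν_{0,s} = 1` and, for `r ≥ 1`,
`ν_{r,s} = ∑_{j=0}^{⌊s/r⌋} (3 ν_{r-1,r})^j · ν^{(I)}_{r, s-jr}` where
`ν^{(I)}_{r,s} = ∑_{j=0}^{⌊s/r⌋} (ν_{r-1,r})^j · ν_{r-1, s-jr}`
(the inner sum below is exactly `ν^{(I)}_{r, s-j(r)}`). -/
def nu : ℕ → ℕ → ℕ
  | 0, _ => 1
  | r + 1, s =>
      ∑ j ∈ Finset.range (s / (r + 1) + 1),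
        (3 * nu r (r + 1)) ^ j *
          (∑ i ∈ Finset.range ((s - j * (r + 1)) / (r + 1) + 1),
            (nu r (r + 1)) ^ i * nu r ((s - j * (r + 1)) - i * (r + 1)))

/-- The auxiliary sequence `ν^{(I)}_{r,s}` (for `r ≥ 1`):
`ν^{(I)}_{r,s} = ∑_{j=0}^{⌊s/r⌋} (ν_{r-1,r})^j · ν_{r-1, s-jr}`. -/
def nuI : ℕ → ℕ → ℕ
  | 0, _ => 1
  | r + 1, s =>
      ∑ j ∈ Finset.range (s / (r + 1) + 1),
        (nu r (r + 1)) ^ j * nu r (s - j * (r + 1))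

/-- geometric-type sum -/
def geomSum (c : ℕ) (g : ℕ → ℕ) (m s : ℕ) : ℕ :=
  ∑ j ∈ Finset.range (s / m + 1), c ^ j * g (s - j * m)

theorem geomSum_lt (c : ℕ) (g : ℕ → ℕ) (m s : ℕ) (h : s < m) : geomSum c g m s = g s := by
  simp [geomSum, Nat.div_eq_of_lt h]

theorem geomSum_ge (c : ℕ) (g : ℕ → ℕ) (m s : ℕ) (hm : 0 < m) :
    geomSum c g m (s + m) = g (s + m) + c * geomSum c g m s := by
  unfold geomSum
  rw [Nat.add_div_right s hm, Finset.sum_range_succ', Finset.mul_sum, add_comm]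
  congr 1
  · simp
  · apply Finset.sum_congr rfl
    intro j _
    have : s + m - (j + 1) * m = s - j * m := by
      rw [Nat.succ_mul]; omega
    rw [this, pow_succ]; ring

theorem geomSum_le (c : ℕ) (g : ℕ → ℕ) (m s : ℕ) : g s ≤ geomSum c g m s := by
  unfold geomSum
  rw [Finset.sum_range_succ']
  simp

theorem nuI_succ (r s : ℕ) :
    nuI (r + 1) s = geomSum (nu r (r + 1)) (nu r) (r + 1) s := by
  simp only [nuI, geomSum]

theorem nu_succ (r s : ℕ) :
    nu (r + 1) s = geomSum (3 * nu r (r + 1)) (nuI (r + 1)) (r + 1) s := by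
  simp only [nu, nuI, geomSum]

theorem nu_lt (r s : ℕ) (h : s < r + 1) : nu (r + 1) s = nu r s := by
  rw [nu_succ, geomSum_lt _ _ _ _ h, nuI_succ, geomSum_lt _ _ _ _ h]

theorem nuI_le (r s : ℕ) : nuI (r + 1) s ≤ nu (r + 1) s := by
  rw [nu_succ]; exact geomSum_le _ _ _ _

theorem nu_mono_succ (r s : ℕ) : nu r s ≤ nu (r + 1) s := by
  refine le_trans ?_ (nuI_le r s)
  rw [nuI_succ]; exact geomSum_le _ _ _ _

theorem nu_eq (r s : ℕ) : nu (r + 1) (s + (r + 1)) = nu r (s + (r + 1))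
    + nu r (r + 1) * nuI (r + 1) s + 3 * nu r (r + 1) * nu (r + 1) s := by
  rw [nu_succ r (s + (r + 1)), geomSum_ge _ _ _ _ (Nat.succ_pos r), ← nu_succ,
    nuI_succ r (s + (r + 1)), geomSum_ge _ _ _ _ (Nat.succ_pos r), ← nuI_succ]

theorem nu_rec_le (r s : ℕ) : nu (r + 1) (s + (r + 1)) ≤ nu r (s + (r + 1))
    + 4 * (nu r (r + 1) * nu (r + 1) s) := by
  rw [nu_eq]
  have := Nat.mul_le_mul_left (nu r (r + 1)) (nuI_le r s)
  linarith

theorem nu_zero_right (r : ℕ) : nu r 0 = 1 := by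
  induction r with
  | zero => simp [nu]
  | succ r ih => rw [nu_lt r 0 (by omega), ih]

theorem nu_diag (r : ℕ) : nu (r + 1) (r + 1) = 5 * nu r (r + 1) := by
  have h := nu_eq r 0
  rw [nuI_succ, geomSum_lt _ _ _ _ (Nat.succ_pos r), nu_zero_right, nu_zero_right] at h
  simp only [zero_add] at h
  rw [h]; ring

theorem nu_le_diag (k s : ℕ) : nu k s ≤ nu s s := by
  rcases le_total k s with h | h
  · exact monotone_nat_of_le_succ (f := fun k => nu k s) (fun n => nu_mono_succ n s) h
  · induction k, h using Nat.le_induction with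
    | base => exact le_rfl
    | succ k hk ih => rw [nu_lt k s (by omega)]; exact ih

theorem nu_sum_le (r s : ℕ) (h : r ≤ s) :
    nu r s ≤ 1 + 4 * ∑ k ∈ Finset.range r, nu k (k + 1) * nu (k + 1) (s - (k + 1)) := by
  induction r with
  | zero => simp [nu]
  | succ r ih =>
    have h1 := ih (by omega)
    obtain ⟨t, rfl⟩ := Nat.exists_eq_add_of_le' h
    have h2 := nu_rec_le r t
    rw [Finset.sum_range_succ, Nat.add_sub_cancel]
    linarith

theorem alpha_le (r : ℕ) : nu r (r + 1) ≤ 25 ^ r * catalan r := by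
  induction r using Nat.strong_induction_on with
  | _ r ih =>
    cases r with
    | zero => simp [nu]
    | succ n =>
      have h1 := nu_sum_le (n + 1) (n + 1 + 1) (by omega)
      have h2 : ∑ k ∈ Finset.range (n + 1), nu k (k + 1) * nu (k + 1) (n + 1 + 1 - (k + 1))
          ≤ 5 * 25 ^ n * catalan (n + 1) := by
        rw [catalan_succ, Fin.sum_univ_eq_sum_range (fun i => catalan i * catalan (n - i)),
          Finset.mul_sum]
        apply Finset.sum_le_sum
        intro k hk
        have hk' : k < n + 1 := Finset.mem_range.mp hk
        obtain ⟨m, rfl⟩ := Nat.exists_eq_add_of_le (Nat.lt_succ_iff.mp hk')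
        have e : k + m + 1 + 1 - (k + 1) = m + 1 := by omega
        rw [e, Nat.add_sub_cancel_left]
        calc nu k (k + 1) * nu (k + 1) (m + 1)
            ≤ nu k (k + 1) * (5 * nu m (m + 1)) :=
              Nat.mul_le_mul_left _ ((nu_le_diag _ _).trans (nu_diag m).le)
          _ ≤ (25 ^ k * catalan k) * (5 * (25 ^ m * catalan m)) :=
              Nat.mul_le_mul (ih k (by omega)) (Nat.mul_le_mul_left _ (ih m (by omega)))
          _ = _ := by rw [pow_add]; ring
      have h3 : 0 < catalan (n + 1) := by
        have h := succ_mul_catalan_eq_centralBinom (n + 1)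
        have := Nat.centralBinom_pos (n + 1)
        rcases Nat.eq_zero_or_pos (catalan (n + 1)) with h0 | h0
        · rw [h0] at h; omega
        · exact h0
      have h4 : 0 < 25 ^ n * catalan (n + 1) := by positivity
      rw [pow_succ]
      nlinarith

theorem catalan_le_four_pow (n : ℕ) : catalan n ≤ 4 ^ n := by
  have h := succ_mul_catalan_eq_centralBinom n
  have h2 : Nat.centralBinom n ≤ 2 ^ (2 * n) := Nat.choose_le_two_pow _ _
  rw [pow_mul] at h2
  norm_num at h2
  nlinarith [Nat.zero_le (n * catalan n)]

/-- For every `r ≥ 1` the diagonal terms satisfy `ν_{r,r} ≤ 5^{2r-1} C_{r-1}` with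
`C_m` the `m`-th Catalan number; consequently `ν_{r,r} ≤ 5^{2r-1} 4^{r-1} = 100^r/20`. -/
theorem nu_diag_catalan_bound (r : ℕ) (hr : 1 ≤ r) :
    nu r r ≤ 5 ^ (2 * r - 1) * catalan (r - 1) ∧
      nu r r ≤ 5 ^ (2 * r - 1) * 4 ^ (r - 1) ∧
      ((5 ^ (2 * r - 1) * 4 ^ (r - 1) : ℚ) = 100 ^ r / 20) := by
  obtain ⟨n, rfl⟩ := Nat.exists_eq_add_of_le' hr
  have e : 2 * (n + 1) - 1 = 2 * n + 1 := by omega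
  rw [e, Nat.add_sub_cancel]
  have key : nu (n + 1) (n + 1) ≤ 5 ^ (2 * n + 1) * catalan n := by
    rw [nu_diag, pow_succ, pow_mul]
    have := alpha_le n
    norm_num
    linarith
  refine ⟨key, key.trans (Nat.mul_le_mul_left _ (catalan_le_four_pow n)), ?_⟩
  have h100 : (100 : ℚ) ^ n = 5 ^ (2 * n) * 4 ^ n := by
    rw [pow_mul, ← mul_pow]; norm_num
  rw [pow_succ, pow_succ, h100]
  ring
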